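/- arXiv:1307.0638 — 3 statements merged into one kernel-verified Lean document; each statement's English description precedes it below -/
import Mathlib

section
/- Let f, g: ℝ → ℝ be additive functions and n, m nonzero integers with n ≠ m, satisfying f(x^n) = x^(n−m) g(x^m) for all nonzero real x. Then the functions F(x) = f(x) − f(1)x and G(x) = g(x) − g(1)x are derivations and n F(x) = m G(x) for all x ∈ ℝ. -/
open Polynomial in
theorem coeff_one_add_C_mul_X_pow {R : Type*} [CommSemiring R] (x : R) (n k : ℕ) :
    ((1 + C x * X) ^ n : R[X]).coeff k = n.choose k * x ^ k := by
  have h : ((1 + C x * X) ^ n : R[X]) = ((1 + X) ^ n).comp (C x * X) := by simp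
  rw [h, comp_C_mul_X_coeff, coeff_one_add_X_pow]

open Polynomial in
/-- Applying an additive map to the coefficients of a polynomial commutes with evaluation at
natural numbers. -/
theorem AddMonoidHom.exists_polynomial_map {R : Type*} [CommSemiring R] (F : R →+ R) (Q : R[X]) :
    ∃ P : R[X], (∀ i, P.coeff i = F (Q.coeff i)) ∧ ∀ t : ℕ, P.eval (t : R) = F (Q.eval (t : R)) := by
  induction Q using Polynomial.induction_on' with
  | add p q hp hq =>
    obtain ⟨P, hP, hP'⟩ := hp
    obtain ⟨P₂, hP₂, hP₂'⟩ := hq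
    exact ⟨P + P₂, fun i => by simp [hP, hP₂], fun t => by simp [hP', hP₂']⟩
  | monomial k a =>
    refine ⟨monomial k (F a), fun i => ?_, fun t => ?_⟩
    · simp only [coeff_monomial]
      split_ifs <;> simp
    · have h := map_nsmul F (t ^ k) a
      simp only [nsmul_eq_mul, Nat.cast_pow] at h
      rw [eval_monomial, eval_monomial, mul_comm a, h, mul_comm]

open Polynomial in
theorem Polynomial.eq_of_eval_natCast_eq_of_ne_zero {K : Type*} [Field K] [CharZero K] {p q r : K[X]}
    (hr : r ≠ 0) (h : ∀ t : ℕ, r.eval (t : K) ≠ 0 → p.eval (t : K) = q.eval (t : K)) : p = q := by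
  have h0 : r * (p - q) = 0 := by
    refine eq_of_infinite_eval_eq _ _
      ((Set.infinite_range_of_injective (Nat.cast_injective (R := K))).mono ?_)
    rintro _ ⟨t, rfl⟩
    by_cases ht : r.eval (t : K) = 0
    · simp [ht]
    · simp [h t ht]
  exact sub_eq_zero.mp ((mul_eq_zero.mp h0).resolve_left hr)

open Polynomial in
theorem Polynomial.one_add_C_mul_X_ne_zero {R : Type*} [CommSemiring R] [Nontrivial R] (x : R) :
    (1 + C x * X : R[X]) ≠ 0 := fun h => by
  simpa using congrArg (fun p : R[X] => p.coeff 0) h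

open Polynomial in
theorem Submodule.eq_top_of_forall_pow_mem (S : Submodule ℚ ℝ) {n : ℕ} (hn : n ≠ 0)
    (hS : ∀ v : ℝ, v ≠ 0 → v ^ n ∈ S) : S = ⊤ := by
  refine (Submodule.eq_top_iff').2 fun c => ?_
  by_contra hc
  obtain ⟨l, hl, hSl⟩ := Submodule.exists_le_ker_of_notMem hc
  let F : ℝ →+ ℝ := (Rat.castHom ℝ).toAddMonoidHom.comp l.toAddMonoidHom
  obtain ⟨P, hP, hP'⟩ := F.exists_polynomial_map ((1 + C c * X) ^ n)
  have hP0 : P = 0 := by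
    refine eq_of_eval_natCast_eq_of_ne_zero (one_add_C_mul_X_ne_zero c) fun t ht => ?_
    have h : l ((1 + c * t) ^ n) = 0 := hSl (hS _ (by simpa using ht))
    simp [hP', F, h]
  have h1 := hP 1
  have h2 := map_nsmul F n c
  rw [coeff_one_add_C_mul_X_pow, hP0] at h1
  simp only [nsmul_eq_mul] at h2
  simp only [coeff_zero, Nat.choose_one_right, pow_one, h2] at h1
  have h3 : F c ≠ 0 := by simpa [F] using hl
  exact mul_ne_zero (Nat.cast_ne_zero.2 hn) h3 h1.symm

theorem AddMonoidHom.map_natCast_mul' {R : Type*} [NonAssocSemiring R] (F : R →+ R) (n : ℕ) (x : R) :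
    F (n * x) = n * F x := by
  simpa only [nsmul_eq_mul] using map_nsmul F n x

open Polynomial in
/-- The case of two positive exponents. -/
theorem map_sq_and_mul_eq_of_pow_mul_map_pow (f g : ℝ →+ ℝ) (hf1 : f 1 = 0) (hg1 : g 1 = 0)
    {n m : ℕ} (hn : n ≠ 0) (hnm : n ≠ m)
    (h : ∀ x : ℝ, x ≠ 0 → x ^ m * f (x ^ n) = x ^ n * g (x ^ m)) :
    (∀ x, n * f x = m * g x) ∧ ∀ x, f (x ^ 2) = 2 * x * f x := by
  have coeffs (x : ℝ) : n * f x = m * g x ∧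
      n.choose 2 * f (x ^ 2) + m * x * (n * f x) = m.choose 2 * g (x ^ 2) + n * x * (m * g x) := by
    obtain ⟨P, hP, hP'⟩ := f.exists_polynomial_map ((1 + C x * X) ^ n)
    obtain ⟨Q, hQ, hQ'⟩ := g.exists_polynomial_map ((1 + C x * X) ^ m)
    have key : (1 + C x * X) ^ m * P = (1 + C x * X) ^ n * Q := by
      refine eq_of_eval_natCast_eq_of_ne_zero (one_add_C_mul_X_ne_zero x) fun t ht => ?_
      simpa [hP', hQ'] using h _ ht
    have k1 := congrArg (fun p : ℝ[X] => p.coeff 1) key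
    have k2 := congrArg (fun p : ℝ[X] => p.coeff 2) key
    simp only [coeff_mul, Finset.Nat.antidiagonal_succ, Finset.Nat.antidiagonal_zero,
      coeff_one_add_C_mul_X_pow, hP, hQ, AddMonoidHom.map_natCast_mul'] at k1 k2
    simp [hf1, hg1] at k1 k2
    exact ⟨k1, by linarith⟩
  refine ⟨fun x => (coeffs x).1, fun x => ?_⟩
  have hn' : (n : ℝ) ≠ 0 := Nat.cast_ne_zero.2 hn
  have hnm' : (n : ℝ) - m ≠ 0 := sub_ne_zero.2 (Nat.cast_injective.ne hnm)
  have k2 := (coeffs x).2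
  rw [Nat.cast_choose_two, Nat.cast_choose_two] at k2
  apply mul_left_cancel₀ (mul_ne_zero hn' hnm')
  linear_combination 2 * k2 - (m - 1) * (coeffs (x ^ 2)).1 - 2 * n * x * (coeffs x).1

open Polynomial in
theorem exists_polynomial_eval_eq_pow_mul_map_div (f g : ℝ →+ ℝ) {n m : ℕ} (hn : n ≠ 0)
    (h : ∀ x : ℝ, x ≠ 0 → f (x ^ n) = x ^ (n + m) * g ((x ^ m)⁻¹)) (x c : ℝ) :
    ∃ P : ℝ[X], ∀ t : ℕ, 1 + x * t ≠ 0 →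
      P.eval (t : ℝ) = (1 + x * t) ^ (n + m) * f (c / (1 + x * t) ^ n) := by
  let S : Submodule ℚ ℝ :=
    { carrier := {c | ∃ P : ℝ[X], ∀ t : ℕ, 1 + x * t ≠ 0 →
        P.eval (t : ℝ) = (1 + x * t) ^ (n + m) * f (c / (1 + x * t) ^ n)}
      zero_mem' := ⟨0, by simp⟩
      add_mem' := by
        rintro a b ⟨P, hP⟩ ⟨Q, hQ⟩
        exact ⟨P + Q, fun t ht => by rw [eval_add, hP t ht, hQ t ht, add_div, map_add, mul_add]⟩
      smul_mem' := by
        rintro q a ⟨P, hP⟩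
        refine ⟨q • P, fun t ht => ?_⟩
        rw [eval_smul, hP t ht, smul_div_assoc, map_rat_smul, mul_smul_comm] }
  suffices hS : S = ⊤ from (hS ▸ Submodule.mem_top : c ∈ S)
  refine S.eq_top_of_forall_pow_mem hn fun v hv => ?_
  obtain ⟨P, -, hP⟩ := (g.comp (AddMonoidHom.mulRight (v ^ m)⁻¹)).exists_polynomial_map
    ((1 + C x * X) ^ m)
  refine ⟨C (v ^ (n + m)) * P, fun t ht => ?_⟩
  have ht' := pow_ne_zero (n + m) ht
  rw [← div_pow, h _ (div_ne_zero hv ht), eval_mul, eval_C, hP, div_pow, div_pow, inv_div]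
  simp only [AddMonoidHom.comp_apply, AddMonoidHom.mulRight_apply, eval_pow, eval_add, eval_mul,
    eval_one, eval_C, eval_X, div_eq_mul_inv ((1 + x * (t : ℝ)) ^ m)]
  field_simp

open Polynomial in
/-- The case of a positive and a negative exponent. -/
theorem map_sq_and_mul_eq_of_map_pow_eq_pow_mul_map_inv (f g : ℝ →+ ℝ) (hf1 : f 1 = 0)
    {n m : ℕ} (hn : n ≠ 0)
    (h : ∀ x : ℝ, x ≠ 0 → f (x ^ n) = x ^ (n + m) * g ((x ^ m)⁻¹)) :
    (∀ x, n * f x = -m * g x) ∧ ∀ x, f (x ^ 2) = 2 * x * f x := by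
  have coeffs (x : ℝ) : n * f x = -m * g x ∧
      m.choose 2 * g (x ^ 2) + n * ((n + m) * x * f x - n * f (x ^ 2)) +
        n.choose 2 * f (x ^ 2) = 0 := by
    choose P hP using exists_polynomial_eval_eq_pow_mul_map_div f g hn h x
    have hP0 (c : ℝ) : (P c).coeff 0 = f c := by
      rw [coeff_zero_eq_eval_zero]
      simpa using hP c 0
    have hsum (c : ℝ) : ∑ i ∈ Finset.range (n + 1), C (n.choose i : ℝ) * (X ^ i * P (x ^ i * c)) =
        C (f c) * (1 + C x * X) ^ (n + m) := by
      refine eq_of_eval_natCast_eq_of_ne_zero (one_add_C_mul_X_ne_zero x) fun t ht => ?_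
      replace ht : 1 + x * t ≠ 0 := by simpa using ht
      have hc : c = ∑ i ∈ Finset.range (n + 1),
          ((n.choose i * t ^ i : ℕ) : ℝ) * (x ^ i * c / (1 + x * t) ^ n) := by
        have e : (1 + x * t) ^ n = ∑ i ∈ Finset.range (n + 1), (x * t) ^ i * n.choose i := by
          rw [add_comm, add_pow]; simp
        calc c = (1 + x * t) ^ n * (c / (1 + x * t) ^ n) := by field_simp
          _ = _ := by
            nth_rw 1 [e]
            rw [Finset.sum_mul]
            refine Finset.sum_congr rfl fun i _ => ?_
            push_cast
            ring
      have hfc : f c = ∑ i ∈ Finset.range (n + 1),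
          ((n.choose i * t ^ i : ℕ) : ℝ) * f (x ^ i * c / (1 + x * t) ^ n) := by
        conv_lhs => rw [hc]
        simp only [map_sum, AddMonoidHom.map_natCast_mul']
      simp only [eval_finsetSum, eval_mul, eval_C, eval_pow, eval_X, eval_add, eval_one]
      rw [hfc, Finset.sum_mul]
      refine Finset.sum_congr rfl fun i _ => ?_
      rw [hP _ t ht]
      push_cast
      ring
    have hsum' (c : ℝ) (k : ℕ) :
        ∑ i ∈ Finset.range (k + 1), n.choose i * (P (x ^ i * c)).coeff (k - i) =
          f c * ((n + m).choose k * x ^ k) := by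
      have e := congrArg (fun p : ℝ[X] => p.coeff k) (hsum c)
      simp only [finsetSum_coeff, coeff_C_mul, coeff_X_pow_mul', coeff_one_add_C_mul_X_pow] at e
      rw [← e, Finset.sum_subset (Finset.range_mono (Nat.le_max_right (k + 1) (n + 1)))]
      · refine Finset.sum_subset_zero_on_sdiff
          (Finset.range_mono (Nat.le_max_left (k + 1) (n + 1))) ?_ ?_
        · intro i hi
          simp only [Finset.mem_sdiff, Finset.mem_range] at hi
          rw [if_neg (by lia), mul_zero]
        · intro i hi
          rw [if_pos (by simpa [Nat.lt_succ_iff] using hi)]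
      · intro i _ hi
        rw [Nat.choose_eq_zero_of_lt (by simpa using hi), Nat.cast_zero, zero_mul]
    obtain ⟨Q, hQ, hQ'⟩ := g.exists_polynomial_map ((1 + C x * X) ^ m)
    have hP1 : P 1 = Q := by
      refine eq_of_eval_natCast_eq_of_ne_zero (one_add_C_mul_X_ne_zero x) fun t ht => ?_
      replace ht : 1 + x * t ≠ 0 := by simpa using ht
      rw [hP 1 t ht, hQ', one_div, ← inv_pow, h _ (inv_ne_zero ht)]
      simp [ht]
    have k1 := hsum' 1 1
    have k2 := hsum' 1 2
    have k3 := hsum' x 1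
    simp [Finset.sum_range_succ, hP0, hP1, hf1, hQ, coeff_one_add_C_mul_X_pow,
      AddMonoidHom.map_natCast_mul', ← pow_two] at k1 k2 k3
    exact ⟨by linarith, by linear_combination k2 - n * k3⟩
  refine ⟨fun x => (coeffs x).1, fun x => ?_⟩
  have hn' : (n : ℝ) ≠ 0 := Nat.cast_ne_zero.2 hn
  have hnm' : (n : ℝ) + m ≠ 0 := by positivity
  have k2 := (coeffs x).2
  rw [Nat.cast_choose_two, Nat.cast_choose_two] at k2
  apply mul_left_cancel₀ (mul_ne_zero hn' hnm')
  linear_combination -2 * k2 + (m - 1) * (coeffs (x ^ 2)).1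

theorem AddMonoidHom.leibniz_of_map_sq {K : Type*} [Field K] [CharZero K] (f : K →+ K)
    (hf : ∀ x, f (x ^ 2) = 2 * x * f x) (x y : K) : f (x * y) = x * f y + y * f x := by
  have h := hf (x + y)
  have e : (x + y) ^ 2 = x ^ 2 + y ^ 2 + (x * y + x * y) := by ring
  rw [e, map_add, map_add, map_add, map_add, hf, hf] at h
  apply mul_left_cancel₀ (two_ne_zero (α := K))
  linear_combination h

theorem map_sq_and_mul_eq_of_map_zpow (f g : ℝ →+ ℝ) (hf1 : f 1 = 0) (hg1 : g 1 = 0)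
    {n m : ℤ} (hn : n ≠ 0) (hnm : n ≠ m)
    (h : ∀ x : ℝ, x ≠ 0 → f (x ^ n) = x ^ (n - m) * g (x ^ m)) :
    (∀ x, n * f x = m * g x) ∧ ∀ x, f (x ^ 2) = 2 * x * f x := by
  wlog hpos : 0 < n generalizing n m
  · have := this (n := -n) (m := -m) (by lia) (by lia) (fun x hx => ?_) (by lia)
    · simpa using this
    · have := h x⁻¹ (inv_ne_zero hx)
      rw [inv_zpow', inv_zpow', inv_zpow'] at this
      rw [this]
      congr 2
      ring
  lift n to ℕ using hpos.le
  obtain ⟨m, rfl | rfl⟩ := m.eq_nat_or_neg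
  · refine map_sq_and_mul_eq_of_pow_mul_map_pow f g hf1 hg1 (by lia) (by lia) fun x hx => ?_
    have := h x hx
    rw [zpow_sub₀ hx] at this
    simp only [zpow_natCast] at this
    rw [this]
    field_simp
  · have := map_sq_and_mul_eq_of_map_pow_eq_pow_mul_map_inv f g hf1 (n := n) (m := m) (by lia)
      fun x hx => ?_
    · simpa using this
    · have := h x hx
      rw [sub_neg_eq_add, zpow_neg] at this
      exact_mod_cast this

theorem stmt_8 (f g : ℝ → ℝ)
    (hf : ∀ x y : ℝ, f (x + y) = f x + f y)
    (hg : ∀ x y : ℝ, g (x + y) = g x + g y)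
    (n m : ℤ) (hn : n ≠ 0) (hm : m ≠ 0) (hnm : n ≠ m)
    (heq : ∀ x : ℝ, x ≠ 0 → f (x ^ n) = x ^ (n - m) * g (x ^ m)) :
    (∀ x y : ℝ, (f (x + y) - f 1 * (x + y)) = (f x - f 1 * x) + (f y - f 1 * y)) ∧
    (∀ x y : ℝ, (f (x * y) - f 1 * (x * y)) = x * (f y - f 1 * y) + y * (f x - f 1 * x)) ∧
    (∀ x y : ℝ, (g (x + y) - g 1 * (x + y)) = (g x - g 1 * x) + (g y - g 1 * y)) ∧
    (∀ x y : ℝ, (g (x * y) - g 1 * (x * y)) = x * (g y - g 1 * y) + y * (g x - g 1 * x)) ∧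
    (∀ x : ℝ, (n : ℝ) * (f x - f 1 * x) = (m : ℝ) * (g x - g 1 * x)) := by
  have hfg : f 1 = g 1 := by simpa using heq 1 one_ne_zero
  let F : ℝ →+ ℝ := AddMonoidHom.mk' (fun x => f x - f 1 * x) fun x y => by rw [hf]; ring
  let G : ℝ →+ ℝ := AddMonoidHom.mk' (fun x => g x - g 1 * x) fun x y => by rw [hg]; ring
  have hFG (x : ℝ) (hx : x ≠ 0) : F (x ^ n) = x ^ (n - m) * G (x ^ m) := by
    simp only [F, G, AddMonoidHom.mk'_apply]
    have hnx : x ^ n = x ^ (n - m) * x ^ m := by rw [← zpow_add₀ hx, sub_add_cancel]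
    rw [heq x hx, hfg, hnx]
    ring
  obtain ⟨hmul, hsq⟩ := map_sq_and_mul_eq_of_map_zpow F G (by simp [F]) (by simp [G]) hn hnm hFG
  have hF := F.leibniz_of_map_sq hsq
  refine ⟨F.map_add, hF, G.map_add, fun x y => ?_, hmul⟩
  have hm' : (m : ℝ) ≠ 0 := Int.cast_ne_zero.2 hm
  suffices G (x * y) = x * G y + y * G x from this
  apply mul_left_cancel₀ hm'
  linear_combination n * hF x y - hmul (x * y) + x * hmul y + y * hmul x
end

section
/- Let ε₁, ε₂ ≥ 0, κ ∈ ℝ, and n, m ∈ ℤ \ {0} with n ≠ m. Suppose f: ℝ → ℝ satisfies |f(x+y) − f(x) − f(y)| ≤ ε₁ for all x, y ∈ ℝ and |f(x^n) − κ x^(n−m) f(x^m)| ≤ ε₂ for all nonzero x ∈ ℝ. Then there exist a derivation F: ℝ → ℝ and λ ∈ ℝ such that (n − κ m) F(x) = 0 for all x and |f(x) − (F(x) + λ x)| ≤ ε₁ for all x ∈ ℝ. -/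
open Filter Topology Polynomial

/-- The Hyers stability theorem: an approximately additive real function is uniformly close to an additive one. -/
lemma exists_additive_near (ε : ℝ) (f : ℝ → ℝ)
    (h : ∀ x y : ℝ, |f (x + y) - f x - f y| ≤ ε) :
    ∃ A : ℝ →+ ℝ, ∀ x, |f x - A x| ≤ ε := by
  have hstep : ∀ x : ℝ, ∀ k : ℕ, dist (f (2 ^ k * x) / 2 ^ k) (f (2 ^ (k + 1) * x) / 2 ^ (k + 1)) ≤
      ε / 2 / 2 ^ k := by
    intro x k
    have hk : (0 : ℝ) < 2 ^ k := by positivity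
    have h2 := h (2 ^ k * x) (2 ^ k * x)
    have e : f (2 ^ k * x) / 2 ^ k - f (2 ^ (k + 1) * x) / 2 ^ (k + 1) =
        -(f (2 ^ k * x + 2 ^ k * x) - f (2 ^ k * x) - f (2 ^ k * x)) / 2 / 2 ^ k := by
      rw [show (2 : ℝ) ^ (k + 1) * x = 2 ^ k * x + 2 ^ k * x by ring]
      field_simp
      ring
    rw [Real.dist_eq, e, abs_div, abs_div, abs_neg, abs_of_pos hk, abs_of_pos (two_pos (α := ℝ))]
    gcongr
  have hlim : ∀ x : ℝ, ∃ a, Tendsto (fun k : ℕ ↦ f (2 ^ k * x) / 2 ^ k) atTop (𝓝 a) :=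
    fun x ↦ cauchySeq_tendsto_of_complete (cauchySeq_of_le_geometric_two (hstep x))
  choose A hA using hlim
  have hadd : ∀ x y, A (x + y) = A x + A y := by
    intro x y
    have hlim := (((hA (x + y)).sub (hA x)).sub (hA y))
    have hzero : Tendsto (fun k : ℕ ↦ ε / 2 ^ k) atTop (𝓝 0) :=
      tendsto_const_nhds.div_atTop (tendsto_pow_atTop_atTop_of_one_lt one_lt_two)
    have hlim' := squeeze_zero_norm (f := fun k : ℕ ↦ f (2 ^ k * (x + y)) / 2 ^ k -
      f (2 ^ k * x) / 2 ^ k - f (2 ^ k * y) / 2 ^ k) (fun k ↦ by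
        have hk : (0 : ℝ) < 2 ^ k := by positivity
        rw [← sub_div, ← sub_div, Real.norm_eq_abs, abs_div, abs_of_pos hk, mul_add]
        have := h (2 ^ k * x) (2 ^ k * y)
        gcongr) hzero
    linarith [tendsto_nhds_unique hlim hlim']
  refine ⟨AddMonoidHom.mk' A hadd, fun x ↦ ?_⟩
  have := dist_le_of_le_geometric_two_of_tendsto₀ (hstep x) (hA x)
  simpa [Real.dist_eq] using this

lemma AddMonoidHom.map_ratCast_mul_real (A : ℝ →+ ℝ) (r : ℚ) (x : ℝ) : A (r * x) = r * A x := by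
  have := map_ratCast_smul A ℝ ℝ r x
  simpa using this

lemma AddMonoidHom.map_ratCast_mul_div (A : ℝ →+ ℝ) {r : ℚ} (hr : r ≠ 0) (x : ℝ) :
    A (r * x) / (r * x) = A x / x := by
  rw [A.map_ratCast_mul_real, mul_div_mul_left]
  exact_mod_cast hr

lemma zpow_le_two_pow_natAbs {y : ℝ} (h1 : 1 ≤ y) (h2 : y ≤ 2) (j : ℤ) :
    y ^ j ≤ 2 ^ j.natAbs := by
  calc y ^ j ≤ y ^ (j.natAbs : ℤ) := zpow_le_zpow_right₀ h1 Int.le_natAbs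
    _ = y ^ j.natAbs := zpow_natCast _ _
    _ ≤ 2 ^ j.natAbs := by gcongr

/-- A function of `x` that is invariant under scaling by powers of two is bounded as soon as it is
bounded for `1 ≤ |x| ≤ 2`. -/
lemma forall_abs_le_of_scale_invariant {E : ℝ → ℝ} {M : ℝ}
    (hscale : ∀ (k : ℤ) (x : ℝ), E (2 ^ k * x) = E x)
    (hE : ∀ x, 1 ≤ |x| → |x| ≤ 2 → |E x| ≤ M) {x : ℝ} (hx : x ≠ 0) : |E x| ≤ M := by
  obtain ⟨k, hk1, hk2⟩ := exists_mem_Ico_zpow (abs_pos.2 hx) (one_lt_two (α := ℝ))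
  have hk : (0 : ℝ) < 2 ^ k := by positivity
  rw [← hscale (-k) x]
  have e : |(2 : ℝ) ^ (-k) * x| = |x| / 2 ^ k := by
    rw [abs_mul, zpow_neg, abs_inv, abs_of_pos hk]
    ring
  refine hE _ ?_ ?_
  · rw [e, le_div_iff₀ hk]
    linarith
  · rw [e, div_le_iff₀ hk]
    rw [zpow_add_one₀ two_ne_zero] at hk2
    linarith

lemma exists_abs_quotient_sub_le {ε₁ ε₂ κ : ℝ} {n m : ℤ} {f : ℝ → ℝ} (A : ℝ →+ ℝ)
    (hA : ∀ x, |f x - A x| ≤ ε₁)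
    (h2 : ∀ x : ℝ, x ≠ 0 → |f (x ^ n) - κ * x ^ (n - m) * f (x ^ m)| ≤ ε₂) :
    ∃ M, ∀ x : ℝ, x ≠ 0 → |A (x ^ n) / x ^ n - κ * (A (x ^ m) / x ^ m)| ≤ M := by
  have hε₁ : 0 ≤ ε₁ := (abs_nonneg _).trans (hA 0)
  have hε₂ : 0 ≤ ε₂ := (abs_nonneg _).trans (h2 1 one_ne_zero)
  refine ⟨(ε₂ + ε₁) * 2 ^ (-n).natAbs + |κ| * ε₁ * 2 ^ (-m).natAbs, fun x hx ↦
    forall_abs_le_of_scale_invariant (E := fun x ↦ A (x ^ n) / x ^ n - κ * (A (x ^ m) / x ^ m))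
      ?_ ?_ hx⟩
  · intro k x
    have hpow : ∀ j : ℤ, A ((2 ^ k * x) ^ j) / (2 ^ k * x) ^ j = A (x ^ j) / x ^ j := by
      intro j
      have := A.map_ratCast_mul_div (r := (2 ^ k) ^ j) (by positivity) (x ^ j)
      push_cast at this
      rwa [mul_zpow]
    simp only [hpow]
  · intro y hy1 hy2
    have hy : y ≠ 0 := by
      rintro rfl
      norm_num at hy1
    have hn := zpow_ne_zero n hy
    have hm := zpow_ne_zero m hy
    have e : A (y ^ n) / y ^ n - κ * (A (y ^ m) / y ^ m) =
        ((f (y ^ n) - κ * y ^ (n - m) * f (y ^ m)) - (f (y ^ n) - A (y ^ n))) * y ^ (-n) +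
          κ * (f (y ^ m) - A (y ^ m)) * y ^ (-m) := by
      rw [zpow_sub₀ hy, zpow_neg, zpow_neg]
      field_simp
      ring
    have hbn := zpow_le_two_pow_natAbs hy1 hy2 (-n)
    have hbm := zpow_le_two_pow_natAbs hy1 hy2 (-m)
    simp only [e]
    refine (abs_add_le _ _).trans ?_
    simp only [abs_mul, abs_zpow]
    have hd : |f (y ^ n) - κ * y ^ (n - m) * f (y ^ m) - (f (y ^ n) - A (y ^ n))| ≤ ε₂ + ε₁ :=
      (abs_sub _ _).trans (add_le_add (h2 y hy) (hA _))
    have := hA (y ^ m)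
    gcongr

/-- A polynomial of degree at most `d` that is `O(|1 + x t| ^ d)` is a multiple of
`(1 + x t) ^ d`; if it also vanishes at `0`, it is zero. -/
lemma Polynomial.eq_zero_of_abs_eval_le {P : ℝ[X]} {d : ℕ} {x M : ℝ} (hx : x ≠ 0)
    (hd : P.natDegree ≤ d) (h0 : P.eval 0 = 0)
    (hP : ∀ t : ℝ, |P.eval t| ≤ M * |1 + t * x| ^ d) : P = 0 := by
  by_contra hne
  set a : ℝ := -x⁻¹ with ha
  have ha0 : a ≠ 0 := by simp [ha, hx]
  have hat : ∀ t, 1 + t * x = x * (t - a) := by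
    intro t
    rw [ha]
    field_simp
    ring
  obtain ⟨g, hg, hndvd⟩ := exists_eq_pow_rootMultiplicity_mul_and_not_dvd P hne a
  set k := P.rootMultiplicity a
  have hga : g.eval a ≠ 0 := fun h ↦ hndvd (dvd_iff_isRoot.2 h)
  have hg0 : g ≠ 0 := by
    rintro rfl
    simp at hga
  have hdeg : P.natDegree = k + g.natDegree := by
    rw [hg, natDegree_mul (pow_ne_zero _ (X_sub_C_ne_zero a)) hg0, natDegree_pow,
      natDegree_X_sub_C, mul_one]
  rcases lt_or_ge k d with hk | hk
  · obtain ⟨j, rfl⟩ := Nat.exists_eq_add_of_lt hk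
    apply hga
    have hbound : ∀ t ∈ ({a}ᶜ : Set ℝ), |g.eval t| ≤ M * |x| ^ (k + j + 1) * |t - a| ^ (j + 1) := by
      intro t ht
      have hta : 0 < |t - a| ^ k := pow_pos (abs_pos.2 (sub_ne_zero.2 ht)) _
      have h := hP t
      rw [hat, hg, eval_mul, eval_pow, eval_sub, eval_X, eval_C, abs_mul, abs_mul, abs_pow,
        mul_pow] at h
      refine le_of_mul_le_mul_left (h.trans_eq ?_) hta
      ring
    have hl : Tendsto (fun t ↦ |g.eval t|) (𝓝[≠] a) (𝓝 |g.eval a|) :=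
      (g.continuous.abs.tendsto a).mono_left nhdsWithin_le_nhds
    have hr : Tendsto (fun t ↦ M * |x| ^ (k + j + 1) * |t - a| ^ (j + 1)) (𝓝[≠] a) (𝓝 0) := by
      have hc : Continuous (fun t ↦ M * |x| ^ (k + j + 1) * |t - a| ^ (j + 1)) := by fun_prop
      simpa using (hc.tendsto a).mono_left nhdsWithin_le_nhds
    have := le_of_tendsto_of_tendsto hl hr (eventually_nhdsWithin_of_forall hbound)
    exact abs_nonpos_iff.1 this
  · have hgdeg : g.natDegree = 0 := by omega
    rw [eq_C_of_natDegree_eq_zero hgdeg] at hg hga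
    rw [hg] at h0
    simp [ha0] at h0 hga
    exact hga h0

/-- The polynomial in `t` that interpolates `L ((1 + t * x) ^ N)` at rational `t`. -/
noncomputable def binomialPolynomial (L : ℝ →+ ℝ) (N : ℕ) (x : ℝ) : ℝ[X] :=
  ∑ i ∈ Finset.range (N + 1), C (N.choose i * L (x ^ i)) * X ^ i

lemma binomialPolynomial_coeff (L : ℝ →+ ℝ) (N : ℕ) (x : ℝ) (i : ℕ) :
    (binomialPolynomial L N x).coeff i = N.choose i * L (x ^ i) := by
  simp only [binomialPolynomial, finsetSum_coeff, coeff_C_mul_X_pow, Finset.sum_ite_eq,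
    Finset.mem_range]
  split_ifs with h
  · rfl
  · rw [Nat.choose_eq_zero_of_lt (by omega)]
    simp

lemma binomialPolynomial_natDegree_le (L : ℝ →+ ℝ) (N : ℕ) (x : ℝ) :
    (binomialPolynomial L N x).natDegree ≤ N := by
  refine natDegree_le_iff_coeff_eq_zero.2 fun i hi ↦ ?_
  rw [binomialPolynomial_coeff, Nat.choose_eq_zero_of_lt hi]
  simp

lemma binomialPolynomial_eval_ratCast (L : ℝ →+ ℝ) (N : ℕ) (x : ℝ) (r : ℚ) :
    (binomialPolynomial L N x).eval (r : ℝ) = L ((1 + r * x) ^ N) := by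
  rw [add_comm, add_pow, map_sum, binomialPolynomial, eval_finsetSum]
  refine Finset.sum_congr rfl fun i _ ↦ ?_
  have := L.map_ratCast_mul_real (r ^ i * N.choose i) (x ^ i)
  push_cast at this
  rw [show ((r : ℝ) * x) ^ i * 1 ^ (N - i) * (N.choose i : ℝ) = r ^ i * N.choose i * x ^ i by
    rw [one_pow, mul_pow]; ring, this]
  simp only [eval_mul, eval_C, eval_pow, eval_X]
  ring

lemma binomialPolynomial_id_eval (N : ℕ) (x t : ℝ) :
    (binomialPolynomial (AddMonoidHom.id ℝ) N x).eval t = (1 + t * x) ^ N := by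
  rw [add_comm 1, add_pow, binomialPolynomial, eval_finsetSum]
  refine Finset.sum_congr rfl fun i _ ↦ ?_
  simp only [eval_mul, eval_C, eval_pow, eval_X, AddMonoidHom.id_apply, mul_pow, one_pow]
  ring

lemma Polynomial.coeff_two_mul {R : Type*} [Semiring R] (p q : R[X]) :
    (p * q).coeff 2 = p.coeff 0 * q.coeff 2 + p.coeff 1 * q.coeff 1 + p.coeff 2 * q.coeff 0 := by
  rw [coeff_mul, Finset.Nat.sum_antidiagonal_eq_sum_range_succ_mk]
  simp [Finset.sum_range_succ]

/-- The relation `B (x ^ N) / x ^ N = K * (B (x ^ M) / x ^ M)` up to a bounded error, for distinct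
natural exponents with `N ≠ 0`, forces `B (x ^ 2) = 2 * x * B x`. -/
lemma map_sq_of_natural_exponents (B : ℝ →+ ℝ) (hB : B 1 = 0) {N M : ℕ} (hN : N ≠ 0)
    (hNM : N ≠ M) {K D : ℝ}
    (h : ∀ x : ℝ, x ≠ 0 → |B (x ^ N) / x ^ N - K * (B (x ^ M) / x ^ M)| ≤ D) (x : ℝ) :
    B (x ^ 2) = 2 * x * B x := by
  have hcoeff : ∀ x : ℝ, x ≠ 0 → N * B x = K * (M * B x) ∧
      M * x * (N * B x) + N * (N - 1) / 2 * B (x ^ 2) =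
        K * (N * x * (M * B x) + M * (M - 1) / 2 * B (x ^ 2)) := by
    intro x hx
    set I := AddMonoidHom.id ℝ
    set P : ℝ[X] := binomialPolynomial I M x * binomialPolynomial B N x -
      C K * (binomialPolynomial I N x * binomialPolynomial B M x) with hPdef
    have hP : P = 0 := by
      refine eq_zero_of_abs_eval_le (d := N + M) (M := D) hx ?_ ?_ ?_
      · refine (natDegree_sub_le _ _).trans (max_le ?_ ?_)
        · refine natDegree_mul_le.trans ?_
          have := binomialPolynomial_natDegree_le I M x
          have := binomialPolynomial_natDegree_le B N x
          omega
        · refine (natDegree_C_mul_le _ _).trans (natDegree_mul_le.trans ?_)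
          have := binomialPolynomial_natDegree_le I N x
          have := binomialPolynomial_natDegree_le B M x
          omega
      · rw [← coeff_zero_eq_eval_zero]
        simp [hPdef, mul_coeff_zero, binomialPolynomial_coeff, hB]
      · have hclosed : IsClosed {t : ℝ | |P.eval t| ≤ D * |1 + t * x| ^ (N + M)} :=
          isClosed_le P.continuous.abs (by fun_prop)
        have hrat : ∀ r : ℚ, |P.eval (r : ℝ)| ≤ D * |1 + (r : ℝ) * x| ^ (N + M) := by
          intro r
          simp only [hPdef, eval_sub, eval_mul, eval_C, I, binomialPolynomial_id_eval]
          simp only [binomialPolynomial_eval_ratCast]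
          set s : ℝ := 1 + r * x
          rcases eq_or_ne s 0 with hs | hs
          · rw [hs]
            rcases eq_or_ne M 0 with rfl | hM
            · simp [hN, hB]
            · simp [hN, hM]
          · have e : s ^ M * B (s ^ N) - K * (s ^ N * B (s ^ M)) =
                (B (s ^ N) / s ^ N - K * (B (s ^ M) / s ^ M)) * s ^ (N + M) := by
              rw [pow_add]
              field_simp
            rw [e, abs_mul, abs_pow]
            gcongr
            exact h s hs
        intro t
        have hdense : closure (Set.range ((↑) : ℚ → ℝ)) = Set.univ :=
          Rat.denseRange_cast.closure_range
        have hsub := closure_minimal (Set.range_subset_iff.2 hrat) hclosed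
        rw [hdense] at hsub
        exact hsub (Set.mem_univ t)
    have h1 : P.coeff 1 = 0 := by rw [hP, coeff_zero]
    have h2 : P.coeff 2 = 0 := by rw [hP, coeff_zero]
    rw [hPdef, coeff_sub, coeff_C_mul] at h1 h2
    simp only [mul_coeff_one, coeff_two_mul,
      binomialPolynomial_coeff, Nat.choose_zero_right, Nat.choose_one_right, pow_zero, pow_one,
      hB, Nat.cast_choose_two, I, AddMonoidHom.id_apply, Nat.cast_one] at h1 h2
    constructor <;> linarith
  by_cases hall : ∀ y, B y = 0
  · simp [hall]
  push Not at hall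
  obtain ⟨y, hy⟩ := hall
  have hKM : K * M = N := by
    have hy0 : y ≠ 0 := by
      rintro rfl
      simp at hy
    have := (hcoeff y hy0).1
    refine mul_right_cancel₀ hy ?_
    linarith
  rcases eq_or_ne x 0 with rfl | hx
  · simp
  have h2 := (hcoeff x hx).2
  have hne : (N : ℝ) * (N - M) ≠ 0 :=
    mul_ne_zero (Nat.cast_ne_zero.2 hN) (sub_ne_zero.2 (Nat.cast_injective.ne hNM))
  refine mul_left_cancel₀ hne ?_
  linear_combination 2 * h2 + (2 * N * x * B x + (M - 1) * B (x ^ 2)) * hKM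

/-- The case of integer exponents with different absolute values reduces to that of their
squares, by iterating the relation. -/
lemma map_sq_of_integer_exponents (B : ℝ →+ ℝ) (hB : B 1 = 0) {n m : ℤ} (hn : n ≠ 0)
    (hnm : n * n ≠ m * m) {κ D : ℝ}
    (h : ∀ x : ℝ, x ≠ 0 → |B (x ^ n) / x ^ n - κ * (B (x ^ m) / x ^ m)| ≤ D) (x : ℝ) :
    B (x ^ 2) = 2 * x * B x := by
  have hN : ((n.natAbs * n.natAbs : ℕ) : ℤ) = n * n := Int.natAbs_mul_self
  have hM : ((m.natAbs * m.natAbs : ℕ) : ℤ) = m * m := Int.natAbs_mul_self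
  refine map_sq_of_natural_exponents B hB (N := n.natAbs * n.natAbs) (M := m.natAbs * m.natAbs)
    (K := κ ^ 2) (D := D + |κ| * D) (by simp [hn]) ?_ ?_ x
  · intro e
    rw [← hN, ← hM, e] at hnm
    exact hnm rfl
  · intro y hy
    have h1 := h (y ^ n) (zpow_ne_zero _ hy)
    have h2 := h (y ^ m) (zpow_ne_zero _ hy)
    rw [← zpow_mul, ← zpow_mul] at h1 h2
    rw [mul_comm m n] at h2
    rw [← zpow_natCast y, ← zpow_natCast y, hN, hM]
    have e : B (y ^ (n * n)) / y ^ (n * n) - κ ^ 2 * (B (y ^ (m * m)) / y ^ (m * m)) =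
        (B (y ^ (n * n)) / y ^ (n * n) - κ * (B (y ^ (n * m)) / y ^ (n * m))) +
        κ * (B (y ^ (n * m)) / y ^ (n * m) - κ * (B (y ^ (m * m)) / y ^ (m * m))) := by ring
    rw [e]
    refine (abs_add_le _ _).trans (add_le_add h1 ?_)
    rw [abs_mul]
    gcongr

/-- If `x * B x⁻¹` and `κ * (B x / x)` differ by a bounded amount, then comparing `B` at the terms
of `x⁻¹ - (x + 1)⁻¹ = (x * (x + 1))⁻¹` shows `B (x ^ 2) = 2 * x * B x`. -/
lemma map_sq_of_inv (B : ℝ →+ ℝ) (hB : B 1 = 0) {κ D : ℝ} (hκ : κ ≠ 0)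
    (h : ∀ x : ℝ, x ≠ 0 → |B x⁻¹ / x⁻¹ - κ * (B x / x)| ≤ D) (x : ℝ) :
    B (x ^ 2) = 2 * x * B x := by
  have hsmall : ∀ y : ℝ, y ≠ 0 → y + 1 ≠ 0 →
      |κ| * |B (y ^ 2) - 2 * y * B y| ≤ D * (|y| * |y + 1| * (|y + 1| + |y| + 1)) := by
    intro y hy hy1
    have hyy : y * (y + 1) ≠ 0 := mul_ne_zero hy hy1
    set d : ℝ → ℝ := fun z ↦ B z⁻¹ / z⁻¹ - κ * (B z / z) with hd
    have hinv : ∀ z, z ≠ 0 → B z⁻¹ = κ * B z / z ^ 2 + d z / z := by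
      intro z hz
      simp only [hd]
      field_simp
      ring
    have hsum : B y⁻¹ = B (y + 1)⁻¹ + B (y * (y + 1))⁻¹ := by
      rw [← map_add]
      congr 1
      field_simp
    have hy2 : B (y * (y + 1)) = B (y ^ 2) + B y := by rw [← map_add]; ring_nf
    rw [hinv y hy, hinv _ hy1, hinv _ hyy, hy2, map_add, hB] at hsum
    have e : κ * (B (y ^ 2) - 2 * y * B y) =
        y * (y + 1) * (d y * (y + 1) - d (y + 1) * y - d (y * (y + 1))) := by
      field_simp at hsum
      linear_combination -hsum
    rw [← abs_mul, e, abs_mul, abs_mul]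
    have hb : |d y * (y + 1) - d (y + 1) * y - d (y * (y + 1))| ≤ D * |y + 1| + D * |y| + D := by
      refine (abs_sub _ _).trans (add_le_add ((abs_sub _ _).trans (add_le_add ?_ ?_)) (h _ hyy))
      · rw [abs_mul]
        gcongr
        exact h y hy
      · rw [abs_mul]
        gcongr
        exact h _ hy1
    calc |y| * |y + 1| * |d y * (y + 1) - d (y + 1) * y - d (y * (y + 1))|
        ≤ |y| * |y + 1| * (D * |y + 1| + D * |y| + D) := by gcongr
      _ = D * (|y| * |y + 1| * (|y + 1| + |y| + 1)) := by ring
  have hshift : ∀ r : ℚ, B ((x - r) ^ 2) - 2 * (x - r) * B (x - r) = B (x ^ 2) - 2 * x * B x := by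
    intro r
    have hr : ∀ q : ℚ, B (q : ℝ) = 0 := fun q ↦ by
      simpa [hB] using B.map_ratCast_mul_real q 1
    have h1 := B.map_ratCast_mul_real (2 * r) x
    have h2 := hr (r ^ 2)
    push_cast at h1 h2
    rw [show (x - r) ^ 2 = x ^ 2 - 2 * r * x + (r : ℝ) ^ 2 by ring, map_add, map_sub, map_sub, h1,
      h2, hr]
    ring
  obtain ⟨u, hu⟩ : ∃ u : ℕ → ℚ, (∀ k, (u k : ℝ) < x ∧ x - 1 < u k) ∧
      Tendsto (fun k ↦ (u k : ℝ)) atTop (𝓝 x) := by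
    have hex : ∀ k : ℕ, ∃ q : ℚ, x - 1 / (k + 1) < q ∧ (q : ℝ) < x := fun k ↦
      exists_rat_btwn (sub_lt_self x (by positivity))
    choose u hu using hex
    refine ⟨u, fun k ↦ ⟨(hu k).2, ?_⟩, ?_⟩
    · have : 1 / ((k : ℝ) + 1) ≤ 1 := by
        rw [div_le_one (by positivity)]
        linarith [(Nat.cast_nonneg k : (0 : ℝ) ≤ k)]
      linarith [(hu k).1]
    · refine tendsto_of_tendsto_of_tendsto_of_le_of_le ?_ tendsto_const_nhds
        (fun k ↦ (hu k).1.le) (fun k ↦ (hu k).2.le)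
      simpa using tendsto_const_nhds.sub (tendsto_one_div_add_atTop_nhds_zero_nat (𝕜 := ℝ))
  have hle : |κ| * |B (x ^ 2) - 2 * x * B x| ≤ 0 := by
    have hc : Continuous (fun t : ℝ ↦
        D * (|x - t| * |x - t + 1| * (|x - t + 1| + |x - t| + 1))) := by fun_prop
    have hl := (hc.tendsto x).comp hu.2
    simp only [sub_self, abs_zero, zero_mul, mul_zero] at hl
    refine ge_of_tendsto' hl fun k ↦ ?_
    rw [← hshift (u k)]
    have := hu.1 k
    exact hsmall _ (by linarith) (by linarith)
  have : |B (x ^ 2) - 2 * x * B x| ≤ 0 := by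
    by_contra! hpos
    exact absurd hle (not_le.2 (mul_pos (abs_pos.2 hκ) hpos))
  exact sub_eq_zero.1 (abs_nonpos_iff.1 this)

lemma exists_zpow_eq_of_pos {x : ℝ} (hx : 0 < x) {n : ℤ} (hn : n ≠ 0) :
    ∃ y : ℝ, y ≠ 0 ∧ y ^ n = x := by
  refine ⟨x ^ ((n : ℝ)⁻¹), (Real.rpow_pos_of_pos hx _).ne', ?_⟩
  rw [← Real.rpow_intCast, ← Real.rpow_mul hx.le, inv_mul_cancel₀ (Int.cast_ne_zero.2 hn),
    Real.rpow_one]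

lemma map_sq_of_abs_quotient_sub_le (B : ℝ →+ ℝ) (hB : B 1 = 0) {n m : ℤ} (hn : n ≠ 0)
    (hnm : n ≠ m) {κ D : ℝ}
    (h : ∀ x : ℝ, x ≠ 0 → |B (x ^ n) / x ^ n - κ * (B (x ^ m) / x ^ m)| ≤ D) (x : ℝ) :
    B (x ^ 2) = 2 * x * B x := by
  rcases eq_or_ne κ 0 with rfl | hκ
  · refine map_sq_of_integer_exponents B hB (m := 2 * n) (κ := 0) (D := D) hn ?_ ?_ x
    · intro e
      have : n * n ≠ 0 := mul_ne_zero hn hn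
      apply this
      linarith
    · simpa using h
  by_cases hsq : n * n = m * m
  · obtain rfl : m = -n := by
      rcases mul_self_eq_mul_self_iff.1 hsq with e | e
      · exact absurd e hnm
      · omega
    refine map_sq_of_inv B hB (D := D) hκ ?_ x
    have hpos : ∀ z : ℝ, 0 < z → |B z⁻¹ / z⁻¹ - κ * (B z / z)| ≤ D := by
      intro z hz
      obtain ⟨y, hy, hyz⟩ := exists_zpow_eq_of_pos hz (neg_ne_zero.2 hn)
      have := h y hy
      rwa [hyz, ← inv_inv (y ^ n), ← zpow_neg, hyz] at this
    intro z hz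
    rcases lt_or_gt_of_ne hz with hz | hz
    · have := hpos (-z) (by linarith)
      simpa only [inv_neg, map_neg, neg_div_neg_eq] using this
    · exact hpos z hz
  · exact map_sq_of_integer_exponents B hB hn hsq h x

lemma map_mul_of_map_sq (B : ℝ →+ ℝ) (h : ∀ x, B (x ^ 2) = 2 * x * B x) (x y : ℝ) :
    B (x * y) = x * B y + y * B x := by
  have h1 := h (x + y)
  rw [show (x + y) ^ 2 = x ^ 2 + (x * y + x * y) + y ^ 2 by ring, map_add, map_add, map_add,
    map_add, h, h] at h1
  linarith

lemma map_zpow_div_of_leibniz {F : ℝ → ℝ} (hF : ∀ x y, F (x * y) = x * F y + y * F x)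
    {x : ℝ} (hx : x ≠ 0) (n : ℤ) : F (x ^ n) / x ^ n = n * (F x / x) := by
  have hone : F 1 = 0 := by
    have := hF 1 1
    norm_num at this
    exact this
  have hmul : ∀ y z : ℝ, y ≠ 0 → z ≠ 0 → F (y * z) / (y * z) = F y / y + F z / z := by
    intro y z hy hz
    rw [hF]
    field_simp
    ring
  induction n with
  | zero => simp [hone]
  | succ k ih =>
    rw [zpow_add_one₀ hx, hmul _ _ (zpow_ne_zero _ hx) hx, ih]
    push_cast
    ring
  | pred k ih =>
    have := hmul (x ^ (-(k : ℤ) - 1)) x (zpow_ne_zero _ hx) hx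
    rw [← zpow_add_one₀ hx, sub_add_cancel, ih] at this
    push_cast at this ⊢
    linarith

lemma eq_zero_of_forall_nat_mul_abs_le {c D : ℝ} (h : ∀ k : ℕ, k * |c| ≤ D) : c = 0 := by
  by_contra hc
  obtain ⟨k, hk⟩ := exists_nat_gt (D / |c|)
  rw [div_lt_iff₀ (abs_pos.2 hc)] at hk
  exact absurd (h k) (not_le.2 hk)

theorem stmt_14 (ε₁ ε₂ : ℝ) (hε₁ : 0 ≤ ε₁) (hε₂ : 0 ≤ ε₂) (κ : ℝ)
    (n m : ℤ) (hn : n ≠ 0) (hm : m ≠ 0) (hnm : n ≠ m) (f : ℝ → ℝ)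
    (h1 : ∀ x y : ℝ, |f (x + y) - f x - f y| ≤ ε₁)
    (h2 : ∀ x : ℝ, x ≠ 0 → |f (x ^ n) - κ * x ^ (n - m) * f (x ^ m)| ≤ ε₂) :
    ∃ (F : ℝ → ℝ) (lam : ℝ),
      (∀ x y : ℝ, F (x + y) = F x + F y) ∧
      (∀ x y : ℝ, F (x * y) = x * F y + y * F x) ∧
      (∀ x : ℝ, ((n : ℝ) - κ * m) * F x = 0) ∧
      (∀ x : ℝ, |f x - (F x + lam * x)| ≤ ε₁) := by
  obtain ⟨A, hA⟩ := exists_additive_near ε₁ f h1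
  obtain ⟨D, hD⟩ := exists_abs_quotient_sub_le A hA h2
  set B : ℝ →+ ℝ := A - AddMonoidHom.mulLeft (A 1) with hBdef
  have hBA : ∀ x, B x = A x - A 1 * x := fun x ↦ rfl
  have hB1 : B 1 = 0 := by simp [hBA]
  have hBD : ∀ x : ℝ, x ≠ 0 → |B (x ^ n) / x ^ n - κ * (B (x ^ m) / x ^ m)| ≤
      D + |A 1 * (1 - κ)| := by
    intro x hx
    have hxn := zpow_ne_zero n hx
    have hxm := zpow_ne_zero m hx
    have e : B (x ^ n) / x ^ n - κ * (B (x ^ m) / x ^ m) =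
        (A (x ^ n) / x ^ n - κ * (A (x ^ m) / x ^ m)) - A 1 * (1 - κ) := by
      rw [hBA, hBA]
      field_simp
      ring
    rw [e]
    exact (abs_sub _ _).trans (add_le_add_left (hD x hx) _)
  have hleib := map_mul_of_map_sq B (map_sq_of_abs_quotient_sub_le B hB1 hn hnm hBD)
  refine ⟨B, A 1, map_add B, hleib, fun x ↦ ?_, fun x ↦ by simpa [hBA] using hA x⟩
  rcases eq_or_ne x 0 with rfl | hx
  · simp
  have hz : ((n : ℝ) - κ * m) * (B x / x) = 0 := by
    refine eq_zero_of_forall_nat_mul_abs_le (D := D + |A 1 * (1 - κ)|) fun k ↦ ?_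
    have hxk := pow_ne_zero k hx
    have hk := hBD (x ^ k) hxk
    rw [map_zpow_div_of_leibniz hleib hxk, map_zpow_div_of_leibniz hleib hxk, ← zpow_natCast,
      map_zpow_div_of_leibniz hleib hx] at hk
    refine le_trans (le_of_eq ?_) hk
    rw [← Nat.abs_cast k, ← abs_mul]
    congr 1
    push_cast
    ring
  rw [← mul_div_assoc, div_eq_zero_iff] at hz
  exact hz.resolve_right hx
end

section
/- Let ε₁, ε₂ ≥ 0, κ ∈ ℝ, and n, m ∈ ℤ \ {0} with n ≠ m and n ≠ κ m. If f: ℝ → ℝ satisfies |f(x+y) − f(x) − f(y)| ≤ ε₁ for all x, y and |f(x^n) − κ x^(n−m) f(x^m)| ≤ ε₂ for all nonzero x, then there exists λ ∈ ℝ such that |f(x) − λ x| ≤ ε₁ for all x ∈ ℝ (stability of linear functions). -/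
open Polynomial in
/-- The coefficients of a polynomial of degree less than `N` are controlled by its values at
`0, …, N - 1`. -/
theorem exists_abs_coeff_le (N i : ℕ) :
    ∃ C : ℝ, ∀ P : ℝ[X], P.degree < N → ∀ K : ℝ,
      (∀ r ∈ Finset.range N, |P.eval (r : ℝ)| ≤ K) → |P.coeff i| ≤ C * K := by
  refine ⟨∑ r ∈ Finset.range N,
    |(Lagrange.basis (Finset.range N) (fun r : ℕ => (r : ℝ)) r).coeff i|, fun P hP K hK => ?_⟩
  have h := Lagrange.eq_interpolate (s := Finset.range N) (v := fun r : ℕ => (r : ℝ)) (f := P)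
    (fun a _ b _ hab => by simpa using hab) (by simpa using hP)
  rw [h, Lagrange.interpolate_apply, Polynomial.finsetSum_coeff, Finset.sum_mul]
  refine (Finset.abs_sum_le_sum_abs _ _).trans (Finset.sum_le_sum fun r hr => ?_)
  rw [Polynomial.coeff_C_mul, abs_mul, mul_comm]
  exact mul_le_mul_of_nonneg_left (hK r hr) (abs_nonneg _)

/-- **Hyers' theorem** for real functions: an approximately additive function is uniformly close
to an additive one. -/
theorem exists_addMonoidHom_abs_sub_le {f : ℝ → ℝ} {ε : ℝ}
    (hf : ∀ x y : ℝ, |f (x + y) - f x - f y| ≤ ε) :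
    ∃ A : ℝ →+ ℝ, ∀ x, |f x - A x| ≤ ε := by
  have hdist : ∀ x : ℝ, ∀ k : ℕ,
      dist (f (2 ^ k * x) / 2 ^ k) (f (2 ^ (k + 1) * x) / 2 ^ (k + 1)) ≤ ε / 2 / 2 ^ k := by
    intro x k
    have h := hf (2 ^ k * x) (2 ^ k * x)
    have e : f (2 ^ k * x) / 2 ^ k - f (2 ^ (k + 1) * x) / 2 ^ (k + 1) =
        -(f (2 ^ k * x + 2 ^ k * x) - f (2 ^ k * x) - f (2 ^ k * x)) / 2 / 2 ^ k := by
      rw [show (2 : ℝ) ^ (k + 1) * x = 2 ^ k * x + 2 ^ k * x by ring]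
      field_simp
      ring
    rw [Real.dist_eq, e, abs_div, abs_div, abs_neg, abs_of_pos (by positivity : (0 : ℝ) < 2 ^ k),
      abs_of_pos (by norm_num : (0 : ℝ) < 2)]
    gcongr
  have hlim : ∀ x : ℝ, ∃ a, Filter.Tendsto (fun k : ℕ => f (2 ^ k * x) / 2 ^ k)
      Filter.atTop (nhds a) :=
    fun x => cauchySeq_tendsto_of_complete (cauchySeq_of_le_geometric_two (hdist x))
  choose a ha using hlim
  have hadd : ∀ x y, a (x + y) = a x + a y := by
    intro x y
    have h0 : Filter.Tendsto (fun k : ℕ => f (2 ^ k * (x + y)) / 2 ^ k -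
        f (2 ^ k * x) / 2 ^ k - f (2 ^ k * y) / 2 ^ k) Filter.atTop (nhds 0) := by
      have hg : Filter.Tendsto (fun k : ℕ => ε * (1 / 2 : ℝ) ^ k) Filter.atTop (nhds 0) := by
        simpa using (tendsto_pow_atTop_nhds_zero_of_lt_one (r := (1 / 2 : ℝ))
          (by norm_num) (by norm_num)).const_mul ε
      refine squeeze_zero_norm (fun k => ?_) hg
      have h := hf (2 ^ k * x) (2 ^ k * y)
      rw [← mul_add] at h
      rw [Real.norm_eq_abs, ← sub_div, ← sub_div, abs_div,
        abs_of_pos (by positivity : (0 : ℝ) < 2 ^ k), one_div, inv_pow, ← div_eq_mul_inv]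
      gcongr
    linarith [tendsto_nhds_unique (((ha (x + y)).sub (ha x)).sub (ha y)) h0]
  refine ⟨AddMonoidHom.mk' a hadd, fun x => ?_⟩
  simpa [Real.dist_eq] using dist_le_of_le_geometric_two_of_tendsto₀ (hdist x) (ha x)

theorem AddMonoidHom.map_two_zpow_mul (A : ℝ →+ ℝ) (j : ℤ) (x : ℝ) :
    A (2 ^ j * x) = 2 ^ j * A x := by
  simpa using map_ratCast_smul A ℝ ℝ ((2 : ℚ) ^ j) x

theorem AddMonoidHom.map_natCast_mul (A : ℝ →+ ℝ) (k : ℕ) (x : ℝ) : A (k * x) = k * A x := by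
  simpa using map_nsmul A k x

theorem exists_eq_two_zpow_mul {x : ℝ} (hx : 0 < x) :
    ∃ j : ℤ, ∃ y ∈ Set.Icc (1 : ℝ) 2, x = 2 ^ j * y := by
  obtain ⟨j, h1, h2⟩ := exists_mem_Ico_zpow hx (one_lt_two : (1 : ℝ) < 2)
  have hj : (0 : ℝ) < 2 ^ j := by positivity
  refine ⟨j, x / 2 ^ j, ⟨(one_le_div hj).2 h1, (div_le_iff₀ hj).2 ?_⟩, by field_simp⟩
  rw [zpow_add₀ (by norm_num), zpow_one] at h2
  linarith

/-- The quotient of an additive function by the identity. -/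
noncomputable def slope₀ (A : ℝ →+ ℝ) (x : ℝ) : ℝ := A x / x

theorem slope₀_two_zpow_mul (A : ℝ →+ ℝ) (j : ℤ) (x : ℝ) :
    slope₀ A (2 ^ j * x) = slope₀ A x := by
  have hj : (2 : ℝ) ^ j ≠ 0 := by positivity
  rw [slope₀, slope₀, A.map_two_zpow_mul, mul_div_mul_left _ _ hj]

theorem mul_slope₀ (A : ℝ →+ ℝ) {x : ℝ} (hx : x ≠ 0) : x * slope₀ A x = A x := by
  rw [slope₀]
  field_simp

/-- `slope₀ A` turns products into sums up to a bounded error. -/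
def IsQuasiDerivation (A : ℝ →+ ℝ) : Prop :=
  ∃ K : ℝ, ∀ x y : ℝ, 0 < x → 0 < y → |slope₀ A (x * y) - slope₀ A x - slope₀ A y| ≤ K

/-- `slope₀ A (x ^ n)` agrees with `κ * slope₀ A (x ^ m)` up to a bounded error. -/
def SlopePowRel (A : ℝ →+ ℝ) (κ : ℝ) (n m : ℤ) : Prop :=
  ∃ K : ℝ, ∀ x : ℝ, 0 < x → |slope₀ A (x ^ n) - κ * slope₀ A (x ^ m)| ≤ K

theorem exists_abs_slope₀_le {A : ℝ →+ ℝ} {K : ℝ}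
    (hK : ∀ x ∈ Set.Icc (1 : ℝ) 2, |A x| ≤ K) : ∀ x, 0 < x → |slope₀ A x| ≤ K := by
  intro x hx
  obtain ⟨j, y, hy, rfl⟩ := exists_eq_two_zpow_mul hx
  have h1 := hy.1
  rw [slope₀_two_zpow_mul, slope₀, abs_div]
  exact (div_le_self (abs_nonneg _) (h1.trans (le_abs_self y))).trans (hK y hy)

theorem isQuasiDerivation_of_slope₀_bounded {A : ℝ →+ ℝ} {K : ℝ}
    (hK : ∀ x, 0 < x → |slope₀ A x| ≤ K) : IsQuasiDerivation A := by
  refine ⟨3 * K, fun x y hx hy => ?_⟩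
  have h1 := abs_le.1 (hK _ hx)
  have h2 := abs_le.1 (hK _ hy)
  have h3 := abs_le.1 (hK _ (mul_pos hx hy))
  exact abs_le.2 ⟨by linarith, by linarith⟩

theorem isQuasiDerivation_of_sq {A : ℝ →+ ℝ} {K : ℝ}
    (hK : ∀ x ∈ Set.Icc (1 : ℝ) 2, |A (x ^ 2) - 2 * x * A x| ≤ K) : IsQuasiDerivation A := by
  refine ⟨3 * K, fun x y hx hy => ?_⟩
  obtain ⟨i, x, ⟨hx1, hx2⟩, rfl⟩ := exists_eq_two_zpow_mul hx
  obtain ⟨j, y, ⟨hy1, hy2⟩, rfl⟩ := exists_eq_two_zpow_mul hy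
  rw [show (2 : ℝ) ^ i * x * (2 ^ j * y) = 2 ^ i * (2 ^ j * (x * y)) by ring]
  simp only [slope₀_two_zpow_mul]
  have e1 := abs_le.1 (hK x ⟨hx1, hx2⟩)
  have e2 := abs_le.1 (hK y ⟨hy1, hy2⟩)
  have e3 := abs_le.1 (hK ((x + y) / 2) ⟨by linarith, by linarith⟩)
  have s1 : A (x + y) = 2 * A ((x + y) / 2) := by
    rw [← Nat.cast_two, ← A.map_natCast_mul]
    congr 1
    push_cast
    ring
  have s2 : A (x ^ 2) + 2 * A (x * y) + A (y ^ 2) = 4 * A (((x + y) / 2) ^ 2) := by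
    have h1 := A.map_natCast_mul 4 (((x + y) / 2) ^ 2)
    have h2 := A.map_natCast_mul 2 (x * y)
    push_cast at h1 h2
    rw [← h1, ← h2, ← map_add, ← map_add]
    congr 1
    ring
  rw [map_add] at s1
  have s3 : A ((x + y) / 2) = (A x + A y) / 2 := by linarith
  rw [s3] at e3
  have key : |A (x * y) - y * A x - x * A y| ≤ 3 * K := by
    rw [abs_le]
    constructor <;> nlinarith
  have hx0 : 0 < x := by linarith
  have hy0 : 0 < y := by linarith
  have e : slope₀ A (x * y) - slope₀ A x - slope₀ A y =
      (A (x * y) - y * A x - x * A y) / (x * y) := by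
    rw [slope₀, slope₀, slope₀]
    field_simp
  rw [e, abs_div]
  refine (div_le_self (abs_nonneg _) ?_).trans key
  rw [abs_of_pos (mul_pos hx0 hy0)]
  nlinarith

/-- An approximate form of Hua's identity for the exponents `1` and `-1`. -/
theorem isQuasiDerivation_of_inv {A : ℝ →+ ℝ} {κ K : ℝ}
    (hK : ∀ x, 0 < x → |slope₀ A x - κ * slope₀ A x⁻¹| ≤ K) : IsQuasiDerivation A := by
  refine isQuasiDerivation_of_sq (K := 36 * K + 4 * |A 1|) fun x ⟨hx1, hx2⟩ => ?_
  have hx0 : 0 < x := by linarith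
  have e0 := hK (x * (x + 1)) (by positivity)
  have e1 := hK x hx0
  have e2 := hK (x + 1) (by linarith)
  have hinv : slope₀ A (x * (x + 1))⁻¹ = (x + 1) * slope₀ A x⁻¹ - x * slope₀ A (x + 1)⁻¹ := by
    have h : (x * (x + 1))⁻¹ = x⁻¹ - (x + 1)⁻¹ := by
      field_simp
      ring
    have h' : A (x * (x + 1))⁻¹ = A x⁻¹ - A (x + 1)⁻¹ := by rw [h, map_sub]
    simp only [slope₀, h', div_inv_eq_mul]
    ring
  have a0 : x * (x + 1) * slope₀ A (x * (x + 1)) = A (x ^ 2) + A x := by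
    rw [mul_slope₀ A (by positivity), ← map_add]
    congr 1
    ring
  have a1 := mul_slope₀ A hx0.ne'
  have a2 : (x + 1) * slope₀ A (x + 1) = A x + A 1 := by
    rw [mul_slope₀ A (by positivity), map_add]
  rw [hinv] at e0
  generalize slope₀ A (x * (x + 1)) = b0 at *
  generalize slope₀ A x⁻¹ = c1 at *
  generalize slope₀ A (x + 1)⁻¹ = c2 at *
  generalize slope₀ A (x + 1) = b2 at *
  generalize slope₀ A x = b1 at *
  have e : A (x ^ 2) - 2 * x * A x =
      x * (x + 1) * ((b0 - κ * ((x + 1) * c1 - x * c2)) - (x + 1) * (b1 - κ * c1)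
        + x * (b2 - κ * c2)) - x ^ 2 * A 1 := by
    linear_combination -a0 + (x + 1) ^ 2 * a1 - x ^ 2 * a2
  have hK0 : 0 ≤ K := (abs_nonneg _).trans e1
  rw [e]
  calc _ ≤ x * (x + 1) * (K + (x + 1) * K + x * K) + x ^ 2 * |A 1| := by
        refine (abs_sub _ _).trans ?_
        rw [abs_mul, abs_mul (x ^ 2), abs_of_pos (by positivity : 0 < x * (x + 1)),
          abs_of_pos (by positivity : 0 < x ^ 2)]
        gcongr
        refine (abs_add_le _ _).trans (add_le_add ((abs_sub _ _).trans (add_le_add e0 ?_)) ?_)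
        · rw [abs_mul, abs_of_pos (by positivity : 0 < x + 1)]
          gcongr
        · rw [abs_mul, abs_of_pos hx0]
          gcongr
    _ ≤ 2 * (2 + 1) * (K + (2 + 1) * K + 2 * K) + 2 ^ 2 * |A 1| := by gcongr
    _ = _ := by ring

open Polynomial in
/-- The polynomial in `r` whose value at natural `r` is `A ((1 + r * x) ^ N)`. -/
noncomputable def powPoly (A : ℝ →+ ℝ) (N : ℕ) (x : ℝ) : ℝ[X] :=
  ∑ i ∈ Finset.range (N + 1), monomial i (N.choose i * A (x ^ i))

theorem eval_powPoly (A : ℝ →+ ℝ) (N : ℕ) (x : ℝ) (r : ℕ) :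
    (powPoly A N x).eval (r : ℝ) = A ((1 + r * x) ^ N) := by
  rw [powPoly, Polynomial.eval_finsetSum, add_comm (1 : ℝ), add_pow, map_sum]
  refine Finset.sum_congr rfl fun i _ => ?_
  rw [Polynomial.eval_monomial, show ((r : ℝ) * x) ^ i * 1 ^ (N - i) * (N.choose i : ℝ) =
    ((N.choose i * r ^ i : ℕ) : ℝ) * x ^ i by push_cast; ring, A.map_natCast_mul]
  push_cast
  ring

theorem coeff_powPoly (A : ℝ →+ ℝ) (N : ℕ) (x : ℝ) (i : ℕ) :
    (powPoly A N x).coeff i = N.choose i * A (x ^ i) := by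
  rw [powPoly, Polynomial.finsetSum_coeff]
  simp only [Polynomial.coeff_monomial, Finset.sum_ite_eq', Finset.mem_range]
  split_ifs with h
  · rfl
  · rw [Nat.choose_eq_zero_of_lt (by omega)]
    simp

theorem natDegree_powPoly_le (A : ℝ →+ ℝ) (N : ℕ) (x : ℝ) : (powPoly A N x).natDegree ≤ N := by
  rw [Polynomial.natDegree_le_iff_coeff_eq_zero]
  intro i hi
  rw [coeff_powPoly, Nat.choose_eq_zero_of_lt hi]
  simp

theorem isQuasiDerivation_of_slopePowRel_add {A : ℝ →+ ℝ} {κ : ℝ} {M d : ℕ} (hM : M ≠ 0)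
    (hd : d ≠ 0) (h : SlopePowRel A κ ((M + d : ℕ) : ℤ) (M : ℤ)) : IsQuasiDerivation A := by
  obtain ⟨K, hK⟩ := h
  have hK0 : 0 ≤ K := (abs_nonneg _).trans (hK 1 one_pos)
  set N := M + d with hN
  set P : ℝ → Polynomial ℝ := fun x => powPoly A N x -
    Polynomial.C κ * (powPoly (AddMonoidHom.id ℝ) d x * powPoly A M x) with hP
  have hdeg : ∀ x, (P x).degree < (N + 1 : ℕ) := by
    intro x
    refine (Polynomial.degree_le_of_natDegree_le (n := N) ?_).trans_lt (by norm_cast; omega)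
    refine (Polynomial.natDegree_sub_le _ _).trans (max_le (natDegree_powPoly_le _ _ _)
      ((Polynomial.natDegree_C_mul_le _ _).trans (Polynomial.natDegree_mul_le.trans ?_)))
    rw [hN, add_comm M]
    exact add_le_add (natDegree_powPoly_le _ _ _) (natDegree_powPoly_le _ _ _)
  have heval : ∀ x ∈ Set.Icc (1 : ℝ) 2, ∀ r ∈ Finset.range (N + 1),
      |(P x).eval (r : ℝ)| ≤ (1 + N * 2) ^ N * K := by
    intro x ⟨hx1, hx2⟩ r hr
    have hx0 : 0 ≤ x := by linarith
    have hrN : (r : ℝ) ≤ N := by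
      norm_cast
      exact Nat.lt_succ_iff.1 (Finset.mem_range.1 hr)
    have hy : 0 < 1 + r * x := by positivity
    have h1 := hK _ hy
    have e : (P x).eval (r : ℝ) = (1 + r * x) ^ N *
        (slope₀ A ((1 + r * x) ^ (N : ℤ)) - κ * slope₀ A ((1 + r * x) ^ (M : ℤ))) := by
      simp only [hP, Polynomial.eval_sub, Polynomial.eval_mul, Polynomial.eval_C, eval_powPoly,
        AddMonoidHom.id_apply, zpow_natCast]
      rw [← mul_slope₀ A (pow_pos hy N).ne', ← mul_slope₀ A (pow_pos hy M).ne', hN, pow_add]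
      ring
    rw [e, abs_mul, abs_of_pos (pow_pos hy N)]
    gcongr
  have hcoeff : ∀ i, ∃ C : ℝ, ∀ x ∈ Set.Icc (1 : ℝ) 2, |(P x).coeff i| ≤ C := by
    intro i
    obtain ⟨C, hC⟩ := exists_abs_coeff_le (N + 1) i
    exact ⟨_, fun x hx => hC (P x) (hdeg x) _ (heval x hx)⟩
  by_cases hκ : (N : ℝ) = κ * M
  · obtain ⟨C, hC⟩ := hcoeff 2
    have hM' : (M : ℝ) ≠ 0 := by exact_mod_cast hM
    have hd' : (0 : ℝ) < d := by exact_mod_cast Nat.pos_of_ne_zero hd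
    have hN' : (0 : ℝ) < N := by exact_mod_cast (by omega : 0 < N)
    have hNd : (N : ℝ) = M + d := by rw [hN]; push_cast; ring
    refine isQuasiDerivation_of_sq
      (K := (C + |κ * (d * (d - 1) / 2)| * 4 * |A 1|) / (N * d / 2)) fun x hx => ?_
    have h2 := hC x hx
    have e : N * d / 2 * (A (x ^ 2) - 2 * x * A x) =
        (P x).coeff 2 + κ * (d * (d - 1) / 2) * x ^ 2 * A 1 := by
      simp [hP, Polynomial.coeff_mul, Finset.Nat.antidiagonal_succ, coeff_powPoly,
        Nat.cast_choose_two]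
      linear_combination -(d * x * A x + (M - 1) / 2 * A (x ^ 2)) * hκ - N / 2 * A (x ^ 2) * hNd
    rw [le_div_iff₀ (by positivity), mul_comm, ← abs_of_pos (by positivity : 0 < N * d / (2 : ℝ)),
      ← abs_mul, e]
    refine (abs_add_le _ _).trans (add_le_add h2 ?_)
    rw [abs_mul, abs_mul, abs_of_nonneg (sq_nonneg x)]
    have := hx.1
    have := hx.2
    gcongr
    nlinarith
  · obtain ⟨C, hC⟩ := hcoeff 1
    have hκ' : 0 < |N - κ * M| := abs_pos.2 (sub_ne_zero.2 hκ)
    refine isQuasiDerivation_of_slope₀_bounded (exists_abs_slope₀_le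
      (K := (C + |κ * d| * 2 * |A 1|) / |N - κ * M|) fun x hx => ?_)
    have h2 := hC x hx
    have e : (N - κ * M) * A x = (P x).coeff 1 + κ * d * x * A 1 := by
      simp [hP, Polynomial.coeff_mul, Finset.Nat.antidiagonal_succ, coeff_powPoly]
      ring
    rw [le_div_iff₀ hκ', mul_comm, ← abs_mul, e]
    refine (abs_add_le _ _).trans (add_le_add h2 ?_)
    have h1 := hx.1
    have h2 := hx.2
    rw [abs_mul, abs_mul, abs_of_nonneg (by linarith : 0 ≤ x)]
    gcongr

theorem SlopePowRel.square {A : ℝ →+ ℝ} {κ : ℝ} {n m : ℤ} (h : SlopePowRel A κ n m) :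
    SlopePowRel A (κ ^ 2) (n * n) (m * m) := by
  obtain ⟨K, hK⟩ := h
  refine ⟨K + |κ| * K, fun x hx => ?_⟩
  have h1 := hK (x ^ n) (zpow_pos hx n)
  have h2 := hK (x ^ m) (zpow_pos hx m)
  rw [← zpow_mul, ← zpow_mul] at h1 h2
  rw [mul_comm m n] at h2
  rw [show slope₀ A (x ^ (n * n)) - κ ^ 2 * slope₀ A (x ^ (m * m)) =
    (slope₀ A (x ^ (n * n)) - κ * slope₀ A (x ^ (n * m))) +
      κ * (slope₀ A (x ^ (n * m)) - κ * slope₀ A (x ^ (m * m))) by ring]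
  refine (abs_add_le _ _).trans (add_le_add h1 ?_)
  rw [abs_mul]
  gcongr

theorem exists_pos_zpow_eq {n : ℤ} (hn : n ≠ 0) {x : ℝ} (hx : 0 < x) :
    ∃ y : ℝ, 0 < y ∧ y ^ n = x := by
  refine ⟨x ^ (n : ℝ)⁻¹, by positivity, ?_⟩
  rw [← Real.rpow_intCast, ← Real.rpow_mul hx.le, inv_mul_cancel₀ (by exact_mod_cast hn),
    Real.rpow_one]

theorem SlopePowRel.symm {A : ℝ →+ ℝ} {κ : ℝ} {n m : ℤ} (hκ : κ ≠ 0) (h : SlopePowRel A κ n m) :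
    SlopePowRel A κ⁻¹ m n := by
  obtain ⟨K, hK⟩ := h
  refine ⟨|κ⁻¹| * K, fun x hx => ?_⟩
  rw [show slope₀ A (x ^ m) - κ⁻¹ * slope₀ A (x ^ n) =
    -(κ⁻¹ * (slope₀ A (x ^ n) - κ * slope₀ A (x ^ m))) by field_simp; ring, abs_neg, abs_mul]
  exact mul_le_mul_of_nonneg_left (hK x hx) (abs_nonneg _)

theorem SlopePowRel.isQuasiDerivation {A : ℝ →+ ℝ} {κ : ℝ} {n m : ℤ} (hn : n ≠ 0) (hm : m ≠ 0)
    (hnm : n ≠ m) (h : SlopePowRel A κ n m) : IsQuasiDerivation A := by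
  by_cases hneg : m = -n
  · subst hneg
    obtain ⟨K, hK⟩ := h
    refine isQuasiDerivation_of_inv (κ := κ) (K := K) fun x hx => ?_
    obtain ⟨y, hy, rfl⟩ := exists_pos_zpow_eq hn hx
    simpa using hK y hy
  have hsq : n.natAbs * n.natAbs ≠ m.natAbs * m.natAbs := by
    rw [Ne, ← Nat.pow_two, ← Nat.pow_two, Nat.pow_left_inj two_ne_zero]
    omega
  have h2 := h.square
  rw [← Int.natAbs_mul_self, ← Int.natAbs_mul_self] at h2
  have hn2 : n.natAbs * n.natAbs ≠ 0 := by simpa using hn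
  have hm2 : m.natAbs * m.natAbs ≠ 0 := by simpa using hm
  generalize n.natAbs * n.natAbs = N at *
  generalize m.natAbs * m.natAbs = M at *
  rcases Nat.lt_or_gt_of_ne hsq with hlt | hlt
  · by_cases hκ : κ = 0
    · subst hκ
      obtain ⟨K, hK⟩ := h
      refine isQuasiDerivation_of_slope₀_bounded (K := K) fun x hx => ?_
      obtain ⟨y, hy, rfl⟩ := exists_pos_zpow_eq hn hx
      simpa using hK y hy
    · obtain ⟨d, rfl⟩ := Nat.exists_eq_add_of_lt hlt
      exact isQuasiDerivation_of_slopePowRel_add hn2 (Nat.succ_ne_zero d)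
        (h2.symm (pow_ne_zero 2 hκ))
  · obtain ⟨d, rfl⟩ := Nat.exists_eq_add_of_lt hlt
    exact isQuasiDerivation_of_slopePowRel_add hm2 (Nat.succ_ne_zero d) h2

theorem IsQuasiDerivation.zpow {A : ℝ →+ ℝ} (h : IsQuasiDerivation A) (n : ℤ) :
    ∃ K : ℝ, ∀ x, 0 < x → |slope₀ A (x ^ n) - n * slope₀ A x| ≤ K := by
  obtain ⟨K, hK⟩ := h
  induction n with
  | zero => exact ⟨|slope₀ A 1|, fun x _ => by simp⟩
  | succ k ih =>
    obtain ⟨C, hC⟩ := ih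
    refine ⟨K + C, fun x hx => ?_⟩
    have h1 := abs_le.1 (hK _ x (zpow_pos hx k) hx)
    have h2 := abs_le.1 (hC x hx)
    rw [zpow_add_one₀ hx.ne']
    push_cast at h2 ⊢
    exact abs_le.2 ⟨by linarith, by linarith⟩
  | pred k ih =>
    obtain ⟨C, hC⟩ := ih
    refine ⟨K + C, fun x hx => ?_⟩
    have h1 := abs_le.1 (hK _ x (zpow_pos hx (-k - 1)) hx)
    have h2 := abs_le.1 (hC x hx)
    rw [← zpow_add_one₀ hx.ne', sub_add_cancel] at h1
    push_cast at h2 ⊢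
    exact abs_le.2 ⟨by linarith, by linarith⟩

theorem SlopePowRel.eq_mul {A : ℝ →+ ℝ} {κ : ℝ} {n m : ℤ} (hn : n ≠ 0) (hm : m ≠ 0)
    (hnm : n ≠ m) (hκ : (n : ℝ) ≠ κ * m) (h : SlopePowRel A κ n m) (x : ℝ) : A x = A 1 * x := by
  have hq := h.isQuasiDerivation hn hm hnm
  obtain ⟨K, hK⟩ := h
  obtain ⟨Kn, hKn⟩ := hq.zpow n
  obtain ⟨Km, hKm⟩ := hq.zpow m
  have hpos : 0 < |n - κ * m| := abs_pos.2 (sub_ne_zero.2 hκ)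
  have hs : ∀ x, 0 < x → |slope₀ A x| ≤ (K + Kn + |κ| * Km) / |n - κ * m| := by
    intro x hx
    rw [le_div_iff₀ hpos, mul_comm, ← abs_mul, show (n - κ * m) * slope₀ A x =
      (slope₀ A (x ^ n) - κ * slope₀ A (x ^ m)) - (slope₀ A (x ^ n) - n * slope₀ A x) +
        κ * (slope₀ A (x ^ m) - m * slope₀ A x) by ring]
    refine (abs_add_le _ _).trans
      (add_le_add ((abs_sub _ _).trans (add_le_add (hK x hx) (hKn x hx))) ?_)
    rw [abs_mul]
    exact mul_le_mul_of_nonneg_left (hKm x hx) (abs_nonneg _)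
  generalize (K + Kn + |κ| * Km) / |n - κ * m| = C at hs
  have hp : ∀ x, 0 < x → ‖A x‖ ≤ C * ‖x‖ := by
    intro x hx
    rw [← mul_slope₀ A hx.ne', norm_mul, mul_comm]
    exact mul_le_mul_of_nonneg_right (hs x hx) (norm_nonneg x)
  have hb : ∀ x, ‖A x‖ ≤ C * ‖x‖ := by
    intro x
    rcases lt_trichotomy x 0 with hx | rfl | hx
    · simpa using hp (-x) (neg_pos.2 hx)
    · simp
    · exact hp x hx
  have hc : Continuous A := AddMonoidHomClass.continuous_of_bound A C hb
  have := map_real_smul A hc x 1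
  simpa [mul_comm] using this

theorem slopePowRel_of_bound {A : ℝ →+ ℝ} {κ C D : ℝ} {n m : ℤ} (hC : 0 ≤ C) (hD : 0 ≤ D)
    (h : ∀ x, 0 < x → |A (x ^ n) - κ * x ^ (n - m) * A (x ^ m)| ≤ C + D * x ^ (n - m)) :
    SlopePowRel A κ n m := by
  refine ⟨C * 2 ^ |n| + D * 2 ^ |m|, fun x hx => ?_⟩
  obtain ⟨j, y, ⟨hy1, hy2⟩, rfl⟩ := exists_eq_two_zpow_mul hx
  have hy0 : 0 < y := by linarith
  simp only [mul_zpow, ← zpow_mul, slope₀_two_zpow_mul]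
  have hle : ∀ k : ℤ, y ^ (-k) ≤ 2 ^ |k| := fun k =>
    (zpow_le_zpow_right₀ hy1 (neg_le_abs k)).trans
      (zpow_le_zpow_left₀ (abs_nonneg k) hy0.le hy2)
  have e : slope₀ A (y ^ n) - κ * slope₀ A (y ^ m) =
      (A (y ^ n) - κ * y ^ (n - m) * A (y ^ m)) * y ^ (-n) := by
    rw [slope₀, slope₀, zpow_sub₀ hy0.ne', zpow_neg]
    have := (zpow_pos hy0 n).ne'
    have := (zpow_pos hy0 m).ne'
    field_simp
  have e' : (C + D * y ^ (n - m)) * y ^ (-n) = C * y ^ (-n) + D * y ^ (-m) := by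
    rw [add_mul, mul_assoc, ← zpow_add₀ hy0.ne']
    congr 3
    ring
  rw [e, abs_mul, abs_of_pos (zpow_pos hy0 (-n))]
  calc _ ≤ (C + D * y ^ (n - m)) * y ^ (-n) :=
        mul_le_mul_of_nonneg_right (h y hy0) (zpow_pos hy0 _).le
    _ ≤ _ := by
        rw [e']
        exact add_le_add (mul_le_mul_of_nonneg_left (hle n) hC)
          (mul_le_mul_of_nonneg_left (hle m) hD)

theorem stmt_15 (ε₁ ε₂ : ℝ) (hε₁ : 0 ≤ ε₁) (hε₂ : 0 ≤ ε₂) (κ : ℝ)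
    (n m : ℤ) (hn : n ≠ 0) (hm : m ≠ 0) (hnm : n ≠ m) (hκ : (n : ℝ) ≠ κ * m) (f : ℝ → ℝ)
    (h1 : ∀ x y : ℝ, |f (x + y) - f x - f y| ≤ ε₁)
    (h2 : ∀ x : ℝ, x ≠ 0 → |f (x ^ n) - κ * x ^ (n - m) * f (x ^ m)| ≤ ε₂) :
    ∃ lam : ℝ, ∀ x : ℝ, |f x - lam * x| ≤ ε₁ := by
  obtain ⟨A, hA⟩ := exists_addMonoidHom_abs_sub_le h1
  have hrel : SlopePowRel A κ n m := by
    refine slopePowRel_of_bound (C := ε₁ + ε₂) (D := |κ| * ε₁) (by positivity) (by positivity)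
      fun x hx => ?_
    rw [show A (x ^ n) - κ * x ^ (n - m) * A (x ^ m) =
      (f (x ^ n) - κ * x ^ (n - m) * f (x ^ m)) - (f (x ^ n) - A (x ^ n)) +
        κ * x ^ (n - m) * (f (x ^ m) - A (x ^ m)) by ring]
    refine (abs_add_le _ _).trans
      ((add_le_add ((abs_sub _ _).trans (add_le_add (h2 x hx.ne') (hA _)))
        (?_ : _ ≤ |κ| * x ^ (n - m) * ε₁)).trans_eq (by ring))
    rw [abs_mul, abs_mul, abs_of_pos (zpow_pos hx (n - m))]
    exact mul_le_mul_of_nonneg_left (hA _) (by positivity)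
  refine ⟨A 1, fun x => ?_⟩
  rw [← hrel.eq_mul hn hm hnm hκ x]
  exact hA x
end
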